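/- arXiv:2002.08843 — 3 statements merged into one kernel-verified Lean document; each statement's English description precedes it below -/
import Mathlib

section
/- Let f : Z → ℝ be Λ-convex, meaning that for every z ∈ Z and every z̄ ∈ Λ the function t ↦ f(z + t·z̄) is convex on ℝ. If c ∈ ℝ satisfies f(z') ≤ c for all z' ∈ K, then f(z) ≤ c for all z ∈ closure(U). (In other words, closure(U) is contained in the Λ-convex hull of K.) -/
noncomputable section

open Matrix

abbrev En (n : ℕ) := EuclideanSpace ℝ (Fin n)

/-- The space of symmetric trace-free `n × n` real matrices, as a submodule. -/
def S0 (n : ℕ) : Submodule ℝ (Matrix (Fin n) (Fin n) ℝ) where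
  carrier := {σ | σ.IsSymm ∧ σ.trace = 0}
  add_mem' := fun hA hB => ⟨hA.1.add hB.1, by simp [Matrix.trace_add, hA.2, hB.2]⟩
  zero_mem' := ⟨Matrix.isSymm_zero, by simp⟩
  smul_mem' := fun c A hA => ⟨by rw [Matrix.IsSymm, Matrix.transpose_smul, hA.1], by simp [hA.2]⟩

/-- The state space `Z = ℝ × ℝⁿ × ℝⁿ × S₀ × ℝ`. -/
abbrev Zsp (n : ℕ) := ℝ × En n × En n × ↥(S0 n) × ℝ

/-- Outer product `w ⊗ m`. -/
def op {n : ℕ} (w m : En n) : Matrix (Fin n) (Fin n) ℝ := fun i j => w i * m j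

/-- The largest eigenvalue of a (symmetric) matrix, as `sup {ξᵀ A ξ : |ξ| = 1}`. -/
def lamMax {n : ℕ} (A : Matrix (Fin n) (Fin n) ℝ) : ℝ :=
  sSup {r | ∃ ξ : En n, ‖ξ‖ = 1 ∧ r = ∑ i, ∑ j, ξ i * A i j * ξ j}

/-- The matrix `M(z)`. -/
def Mmat {n : ℕ} (μm μp μ : ℝ) (w m : En n) (σ : Matrix (Fin n) (Fin n) ℝ) :
    Matrix (Fin n) (Fin n) ℝ :=
  (((μp - μ) * (μ - μm))⁻¹) •
      ((μ * μm * μp) • op w w - (μm * μp) • (op m w + op w m) + (μp + μm - μ) • op m m) - σ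

/-- `T₊(z)`. -/
def Tp {n : ℕ} (μm μp μ : ℝ) (w m : En n) : ℝ :=
  (μp / (n : ℝ)) * ‖m - μm • w‖ ^ 2 / (μ - μm) ^ 2

/-- `T₋(z)`. -/
def Tm {n : ℕ} (μm μp μ : ℝ) (w m : En n) : ℝ :=
  (μm / (n : ℝ)) * ‖m - μp • w‖ ^ 2 / (μ - μp) ^ 2

def TpZ {n : ℕ} (μm μp : ℝ) (z : Zsp n) : ℝ := Tp μm μp z.1 z.2.1 z.2.2.1

def TmZ {n : ℕ} (μm μp : ℝ) (z : Zsp n) : ℝ := Tm μm μp z.1 z.2.1 z.2.2.1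

def QZ {n : ℕ} (μm μp : ℝ) (z : Zsp n) : ℝ :=
  lamMax (Mmat μm μp z.1 z.2.1 z.2.2.1 (z.2.2.2.1 : Matrix (Fin n) (Fin n) ℝ))

/-- The open relaxed set `U`. -/
def Uset (n : ℕ) (μm μp e : ℝ) : Set (Zsp n) :=
  {z | z.1 ∈ Set.Ioo μm μp ∧ TpZ μm μp z < e ∧ TmZ μm μp z < e ∧ QZ μm μp z < e}

/-- The constraint set `K`. -/
def Kset (n : ℕ) (μm μp e : ℝ) : Set (Zsp n) :=
  {z | (z.1 = μm ∨ z.1 = μp) ∧ z.2.2.1 = z.1 • z.2.1 ∧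
    z.1 • op z.2.1 z.2.1 - (z.2.2.2.1 : Matrix (Fin n) (Fin n) ℝ) =
      e • (1 : Matrix (Fin n) (Fin n) ℝ)}

/-- The wave cone `Λ`. -/
def Lambda (n : ℕ) : Set (Zsp n) :=
  {z | ¬(z.1 = 0 ∧ z.2.2.1 = 0) ∧
    ∃ (ξ : Fin n → ℝ) (c : ℝ), ¬(ξ = 0 ∧ c = 0) ∧
      ((z.2.2.2.1 : Matrix (Fin n) (Fin n) ℝ) +
          z.2.2.2.2 • (1 : Matrix (Fin n) (Fin n) ℝ)).mulVec ξ + c • (fun i => z.2.2.1 i) = 0 ∧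
      (∑ j, z.2.2.1 j * ξ j) + c * z.1 = 0 ∧
      (∑ j, z.2.1 j * ξ j) = 0}

/-- The projection `π(μ, w, m, σ, q) = (μ, w, m, σ)`. -/
def pz {n : ℕ} (z : Zsp n) : ℝ × En n × En n × ↥(S0 n) := (z.1, z.2.1, z.2.2.1, z.2.2.2.1)

lemma exists_ne_zero_orthogonal {n : ℕ} (hn : 2 ≤ n) (x : En n) :
    ∃ ξ : Fin n → ℝ, ξ ≠ 0 ∧ ∑ j, x j * ξ j = 0 := by
  have hker : LinearMap.ker (Fintype.linearCombination ℝ (fun j => x j)) ≠ ⊥ :=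
    LinearMap.ker_ne_bot_of_finrank_lt (by simp; omega)
  obtain ⟨ξ, hξ, hne⟩ := Submodule.exists_mem_ne_zero_of_ne_bot hker
  refine ⟨ξ, hne, ?_⟩
  simpa [Fintype.linearCombination_apply, mul_comm] using hξ

lemma op_mulVec {n : ℕ} (w m : En n) (ξ : Fin n → ℝ) (i : Fin n) :
    (op w m).mulVec ξ i = w i * ∑ j, m j * ξ j := by
  simp [Matrix.mulVec, dotProduct, op, Finset.mul_sum, mul_assoc]

lemma trace_op {n : ℕ} (w m : En n) : (op w m).trace = ∑ i, w i * m i := by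
  simp [Matrix.trace, op]

lemma trace_op_self {n : ℕ} (w : En n) : (op w w).trace = ‖w‖ ^ 2 := by
  rw [trace_op, EuclideanSpace.real_norm_sq_eq]
  simp only [sq]

lemma transpose_op {n : ℕ} (w m : En n) : (op w m)ᵀ = op m w := by
  ext i j
  simp [op, mul_comm]

/-- Directions at constant density along which velocity and momentum are parallel. -/
lemma mem_Lambda_of_parallel {n : ℕ} (hn : 2 ≤ n) {x : En n} (r : En n) (hx : x ≠ 0) {κ : ℝ}
    (hκ : κ ≠ 0) (a g : ℝ) (σ : S0 n)
    (hσ : (σ : Matrix (Fin n) (Fin n) ℝ) = κ • (op r x + op x r) + g • op x x) :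
    ((0, a • x, κ • x, σ, 0) : Zsp n) ∈ Lambda n := by
  obtain ⟨ξ, hξ, hxξ⟩ := exists_ne_zero_orthogonal hn x
  refine ⟨by simp [hκ, hx], ξ, -∑ j, r j * ξ j, by simp [hξ], ?_, ?_, ?_⟩
  · funext i
    simp only [hσ, zero_smul, add_zero, Matrix.add_mulVec, Matrix.smul_mulVec, Pi.add_apply,
      Pi.smul_apply, op_mulVec, hxξ, PiLp.smul_apply, smul_eq_mul, Pi.zero_apply]
    ring
  · simp [mul_assoc, ← Finset.mul_sum, hxξ]
  · simp [mul_assoc, ← Finset.mul_sum, hxξ]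

/-- Differences of two constraint states with different densities. -/
lemma mem_Lambda_of_ne {n : ℕ} (hn : 2 ≤ n) {μ₁ μ₂ : ℝ} (hμ : μ₁ ≠ μ₂) (p r : En n) (σ : S0 n)
    (hσ : (σ : Matrix (Fin n) (Fin n) ℝ) = μ₁ • op p p - μ₂ • op r r) :
    ((μ₁ - μ₂, p - r, μ₁ • p - μ₂ • r, σ, 0) : Zsp n) ∈ Lambda n := by
  obtain ⟨ξ, hξ, hpr⟩ := exists_ne_zero_orthogonal hn (p - r)
  have hrp : ∑ j, r j * ξ j = ∑ j, p j * ξ j := by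
    simp only [PiLp.sub_apply, sub_mul, Finset.sum_sub_distrib] at hpr
    linarith
  refine ⟨by simp [sub_ne_zero.2 hμ], ξ, -∑ j, p j * ξ j, by simp [hξ], ?_, ?_, hpr⟩
  · funext i
    simp only [hσ, zero_smul, add_zero, Matrix.sub_mulVec, Matrix.smul_mulVec, Pi.add_apply,
      Pi.sub_apply, Pi.smul_apply, op_mulVec, hrp, PiLp.smul_apply, PiLp.sub_apply, smul_eq_mul,
      Pi.zero_apply]
    ring
  · simp only [PiLp.sub_apply, PiLp.smul_apply, smul_eq_mul, sub_mul, Finset.sum_sub_distrib,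
      mul_assoc, ← Finset.mul_sum, hrp]
    ring

lemma ConvexOn.apply_zero_le {g : ℝ → ℝ} (hg : ConvexOn ℝ Set.univ g) {s t c : ℝ} (hs : s ≤ 0)
    (ht : 0 ≤ t) (hgs : g s ≤ c) (hgt : g t ≤ c) : g 0 ≤ c :=
  (hg.le_max_of_mem_Icc (Set.mem_univ s) (Set.mem_univ t) ⟨hs, ht⟩).trans (max_le hgs hgt)

/-- Splitting off the rank-one terms `x ⊗ x` of the stress defect one at a time, by moving the
velocity `r` of one of the two phases in the direction `x`. -/
lemma le_of_rankOne_splitting {n : ℕ} (hn : 2 ≤ n) {f : Zsp n → ℝ} {c : ℝ}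
    (hf : ∀ z : Zsp n, ∀ zb ∈ Lambda n, ConvexOn ℝ Set.univ (fun t : ℝ => f (z + t • zb)))
    {θ μ : ℝ} (hθ : 0 ≤ θ) (hμ : 0 < μ) (N μ₀ q : ℝ) (w₀ m₀ : En n)
    (A : Matrix (Fin n) (Fin n) ℝ)
    (hbase : ∀ (r : En n) (σ : S0 n),
      (σ : Matrix (Fin n) (Fin n) ℝ) = A + (θ * μ) • op r r → θ * (N - μ * ‖r‖ ^ 2) = 0 →
      f (μ₀, w₀ + θ • r, m₀ + (θ * μ) • r, σ, q) ≤ c)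
    (L : List (En n)) (r : En n) (σ : S0 n)
    (hσ : (σ : Matrix (Fin n) (Fin n) ℝ) =
      A + (θ * μ) • op r r + (L.map fun x => op x x).sum)
    (hL : (L.map fun x => ‖x‖ ^ 2).sum = θ * (N - μ * ‖r‖ ^ 2)) :
    f (μ₀, w₀ + θ • r, m₀ + (θ * μ) • r, σ, q) ≤ c := by
  induction L generalizing r σ with
  | nil => exact hbase r σ (by simpa using hσ) (by simpa using hL.symm)
  | cons x L ih =>
    simp only [List.map_cons, List.sum_cons] at hσ hL
    by_cases hx : x = 0
    · subst hx
      have h0 : op (0 : En n) 0 = 0 := by ext i j; simp [op]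
      exact ih r σ (by rw [hσ, h0, zero_add]) (by simpa using hL)
    have hx2 : 0 < ‖x‖ ^ 2 := by positivity
    have hθ' : 0 < θ := by
      refine lt_of_le_of_ne hθ fun h => ?_
      have : 0 ≤ (L.map fun x => ‖x‖ ^ 2).sum := by
        refine List.sum_nonneg fun y hy => ?_
        obtain ⟨_, _, rfl⟩ := List.mem_map.1 hy
        positivity
      rw [← h, zero_mul] at hL
      linarith
    obtain ⟨κ, hκdef⟩ : ∃ κ, κ = θ * μ := ⟨_, rfl⟩
    have hκ : 0 < κ := hκdef ▸ mul_pos hθ' hμ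
    rw [← hκdef] at hσ ih ⊢
    obtain ⟨d, hd⟩ : ∃ d, d = inner ℝ r x / ‖x‖ ^ 2 := ⟨_, rfl⟩
    have hdx : inner ℝ r x = d * ‖x‖ ^ 2 := by rw [hd]; field_simp
    have hrx : ∑ i, r i * x i = d * ‖x‖ ^ 2 := by
      rw [← hdx, PiLp.inner_apply]
      simp [mul_comm]
    have hxr : ∑ i, x i * r i = d * ‖x‖ ^ 2 := by simpa only [mul_comm] using hrx
    let τ : S0 n := ⟨κ • (op r x + op x r) + (-(2 * d * κ)) • op x x, by
      refine ⟨?_, ?_⟩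
      · rw [Matrix.IsSymm]
        simp only [Matrix.transpose_add, Matrix.transpose_smul, transpose_op]
        rw [add_comm (op x r)]
      · simp only [Matrix.trace_add, Matrix.trace_smul, trace_op_self, smul_eq_mul, trace_op, hrx,
          hxr]
        ring⟩
    have hτ : (τ : Matrix (Fin n) (Fin n) ℝ) =
        κ • (op r x + op x r) + (-(2 * d * κ)) • op x x := rfl
    have key : ∀ t : ℝ, κ * (t ^ 2 + 2 * d * t) = 1 →
        f ((μ₀, w₀ + θ • r, m₀ + κ • r, σ, q) +
          t • ((0, θ • x, κ • x, τ, 0) : Zsp n)) ≤ c := by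
      intro t ht
      convert ih (r + t • x) (σ + t • τ) ?_ ?_ using 2
      · simp only [Prod.smul_mk, Prod.mk_add_mk, Prod.mk.injEq, smul_zero, add_zero, true_and,
          and_true, smul_add, smul_smul, ← add_assoc]
        exact ⟨by rw [mul_comm t], by rw [mul_comm t]⟩
      · ext i j
        simp only [Submodule.coe_add, Submodule.coe_smul, hτ, hσ, Matrix.add_apply,
          Matrix.smul_apply, op, PiLp.add_apply, PiLp.smul_apply, smul_eq_mul]
        linear_combination (-(x i * x j)) * ht
      · rw [norm_add_sq_real, norm_smul, inner_smul_right, hdx, mul_pow, Real.norm_eq_abs, sq_abs]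
        rw [hκdef] at ht
        linear_combination hL + ‖x‖ ^ 2 * ht
    obtain ⟨s, hs⟩ : ∃ s, s = Real.sqrt (d ^ 2 + 1 / κ) := ⟨_, rfl⟩
    have hs2 : s ^ 2 = d ^ 2 + 1 / κ := by rw [hs]; exact Real.sq_sqrt (by positivity)
    have hds : |d| ≤ s := by
      rw [hs]
      exact Real.abs_le_sqrt (by have : 0 < 1 / κ := by positivity
                                 linarith)
    have hκs : κ * (s ^ 2 - d ^ 2) = 1 := by rw [hs2]; field_simp; ring
    obtain ⟨hds₁, hds₂⟩ := abs_le.1 hds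
    have := (hf (μ₀, w₀ + θ • r, m₀ + κ • r, σ, q) _
      (mem_Lambda_of_parallel hn r hx hκ.ne' θ _ τ hτ)).apply_zero_le (s := -d - s) (t := -d + s)
      (by linarith) (by linarith) (key _ (by linear_combination hκs))
      (key _ (by linear_combination hκs))
    simpa only [zero_smul, add_zero] using this

lemma trace_coe_S0 {n : ℕ} (σ : S0 n) : (σ : Matrix (Fin n) (Fin n) ℝ).trace = 0 := σ.2.2

/-- A mixture of two saturated phases lies in the `Λ`-convex hull. -/
lemma le_of_saturated {n : ℕ} (hn : 2 ≤ n) {μm μp e : ℝ} (hμ : μm < μp) {f : Zsp n → ℝ} {c : ℝ}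
    (hf : ∀ z : Zsp n, ∀ zb ∈ Lambda n, ConvexOn ℝ Set.univ (fun t : ℝ => f (z + t • zb)))
    (hc : ∀ z' ∈ Kset n μm μp e, f z' ≤ c) {θ : ℝ} (hθ₀ : 0 ≤ θ) (hθ₁ : θ ≤ 1) (q : ℝ)
    (p r : En n) (σ : S0 n)
    (hσ : (σ : Matrix (Fin n) (Fin n) ℝ) =
      (θ * μp) • op p p + ((1 - θ) * μm) • op r r - e • (1 : Matrix (Fin n) (Fin n) ℝ))
    (hp : θ * (n * e - μp * ‖p‖ ^ 2) = 0) (hr : (1 - θ) * (n * e - μm * ‖r‖ ^ 2) = 0) :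
    f (θ * μp + (1 - θ) * μm, θ • p + (1 - θ) • r, (θ * μp) • p + ((1 - θ) * μm) • r, σ, q)
      ≤ c := by
  rcases hθ₀.eq_or_lt with rfl | hθ₀
  · apply hc
    refine ⟨Or.inl (by simp), by simp, ?_⟩
    rw [hσ]
    simp
  rcases hθ₁.eq_or_lt with rfl | hθ₁
  · apply hc
    refine ⟨Or.inr (by simp), by simp, ?_⟩
    rw [hσ]
    simp
  have hp' : n * e - μp * ‖p‖ ^ 2 = 0 := by simpa [hθ₀.ne'] using hp
  have hr' : n * e - μm * ‖r‖ ^ 2 = 0 := by simpa [(sub_pos.2 hθ₁).ne'] using hr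
  have phase : ∀ (μ : ℝ) (v : En n), n * e - μ * ‖v‖ ^ 2 = 0 →
      μ • op v v - e • (1 : Matrix (Fin n) (Fin n) ℝ) ∈ S0 n := by
    intro μ v hv
    refine ⟨?_, ?_⟩
    · rw [Matrix.IsSymm]
      simp [transpose_op]
    · simp only [Matrix.trace_sub, Matrix.trace_smul, trace_op_self, Matrix.trace_one,
        Fintype.card_fin, smul_eq_mul]
      linarith
  let σp : S0 n := ⟨_, phase μp p hp'⟩
  let σm : S0 n := ⟨_, phase μm r hr'⟩
  have hdir := mem_Lambda_of_ne hn hμ.ne' p r (σp - σm) (by simp [σp, σm])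
  set zb : Zsp n := (μp - μm, p - r, μp • p - μm • r, σp - σm, 0)
  have := (hf (θ * μp + (1 - θ) * μm, θ • p + (1 - θ) • r, (θ * μp) • p + ((1 - θ) * μm) • r, σ, q)
    _ hdir).apply_zero_le (s := -θ) (t := 1 - θ) (c := c) (by linarith) (by linarith) ?_ ?_
  · simpa only [zero_smul, add_zero] using this
  · apply hc
    refine ⟨Or.inl ?_, ?_, ?_⟩
    · simp [zb]; ring
    · simp [zb]; module
    · have h₁ : θ * μp + (1 - θ) * μm + -θ * (μp - μm) = μm := by ring
      have h₂ : θ • p + (1 - θ) • r + -θ • (p - r) = r := by module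
      simp only [zb, Prod.smul_mk, Prod.mk_add_mk, smul_eq_mul, h₁, h₂, Submodule.coe_add,
        Submodule.coe_smul, AddSubgroupClass.coe_sub, hσ, σp, σm]
      module
  · apply hc
    refine ⟨Or.inr ?_, ?_, ?_⟩
    · simp [zb]; ring
    · simp [zb]; module
    · have h₁ : θ * μp + (1 - θ) * μm + (1 - θ) * (μp - μm) = μp := by ring
      have h₂ : θ • p + (1 - θ) • r + (1 - θ) • (p - r) = p := by module
      simp only [zb, Prod.smul_mk, Prod.mk_add_mk, smul_eq_mul, h₁, h₂, Submodule.coe_add,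
        Submodule.coe_smul, AddSubgroupClass.coe_sub, hσ, σp, σm]
      module

open scoped MatrixOrder in
/-- A positive semidefinite matrix is a sum of rank-one matrices `x ⊗ x`, and it can be split so
that the two groups carry prescribed shares of the trace. -/
lemma exists_rankOne_splitting {n : ℕ} {F : Matrix (Fin n) (Fin n) ℝ} (hF : F.PosSemidef)
    {a b : ℝ} (ha : 0 ≤ a) (hb : 0 ≤ b) (hab : F.trace = a + b) :
    ∃ L₁ L₂ : List (En n),
      F = (L₁.map fun x => op x x).sum + (L₂.map fun x => op x x).sum ∧
      (L₁.map fun x => ‖x‖ ^ 2).sum = a ∧ (L₂.map fun x => ‖x‖ ^ 2).sum = b := by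
  obtain ⟨B, hB⟩ := CStarAlgebra.nonneg_iff_eq_star_mul_self.1 hF.nonneg
  let v : Fin n → En n := fun k => WithLp.toLp 2 (B k)
  have hv : F = ∑ k, op (v k) (v k) := by
    rw [hB]
    ext i j
    simp [Matrix.mul_apply, Matrix.sum_apply, op, v]
  have htr : ∑ k, ‖v k‖ ^ 2 = a + b := by
    rw [← hab, hv, Matrix.trace_sum]
    simp [trace_op_self]
  have hop : ∀ (s : ℝ) (x : En n), 0 ≤ s → op (√s • x) (√s • x) = s • op x x := by
    intro s x hs
    ext i j
    simp only [op, PiLp.smul_apply, Matrix.smul_apply, smul_eq_mul]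
    linear_combination (x i * x j) * Real.mul_self_sqrt hs
  have hnorm : ∀ (s : ℝ) (x : En n), 0 ≤ s → ‖√s • x‖ ^ 2 = s * ‖x‖ ^ 2 := by
    intro s x hs
    rw [norm_smul, mul_pow, Real.norm_eq_abs, sq_abs, Real.sq_sqrt hs]
  have hs₁ : 0 ≤ a / (a + b) := by positivity
  have hs₂ : 0 ≤ 1 - a / (a + b) := by
    have : a / (a + b) ≤ 1 := div_le_one_of_le₀ (by linarith) (by linarith)
    linarith
  have hmul : a / (a + b) * (a + b) = a := div_mul_cancel_of_imp fun h => by linarith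
  refine ⟨List.ofFn fun k => √(a / (a + b)) • v k, List.ofFn fun k => √(1 - a / (a + b)) • v k,
    ?_, ?_, ?_⟩
  · simp only [List.map_ofFn, List.sum_ofFn, Function.comp_apply, hop _ _ hs₁, hop _ _ hs₂,
      ← Finset.smul_sum, ← hv]
    module
  · simp only [List.map_ofFn, List.sum_ofFn, Function.comp_apply, hnorm _ _ hs₁,
      ← Finset.mul_sum, htr, hmul]
  · simp only [List.map_ofFn, List.sum_ofFn, Function.comp_apply, hnorm _ _ hs₂,
      ← Finset.mul_sum, htr]
    linarith

lemma quadForm_le_lamMax {n : ℕ} (A : Matrix (Fin n) (Fin n) ℝ) (ξ : En n) :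
    ∑ i, ∑ j, ξ i * A i j * ξ j ≤ lamMax A * ‖ξ‖ ^ 2 := by
  have hbdd : BddAbove {r | ∃ ξ : En n, ‖ξ‖ = 1 ∧ r = ∑ i, ∑ j, ξ i * A i j * ξ j} := by
    refine ⟨∑ i, ∑ j, |A i j|, ?_⟩
    rintro _ ⟨η, hη, rfl⟩
    refine Finset.sum_le_sum fun i _ => Finset.sum_le_sum fun j _ => ?_
    have hi : |η i| ≤ 1 := by simpa [hη] using PiLp.norm_apply_le η i
    have hj : |η j| ≤ 1 := by simpa [hη] using PiLp.norm_apply_le η j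
    calc η i * A i j * η j ≤ |η i * A i j * η j| := le_abs_self _
      _ = |η i| * |A i j| * |η j| := by rw [abs_mul, abs_mul]
      _ ≤ 1 * |A i j| * 1 := by gcongr
      _ = |A i j| := by ring
  by_cases hξ : ξ = 0
  · simp [hξ]
  have hξ' : ‖ξ‖ ≠ 0 := norm_ne_zero_iff.2 hξ
  have := le_csSup hbdd ⟨‖ξ‖⁻¹ • ξ,
    by rw [norm_smul, norm_inv, norm_norm, inv_mul_cancel₀ hξ'], rfl⟩
  have hscale : ∑ i, ∑ j, ξ i * A i j * ξ j =
      (∑ i, ∑ j, (‖ξ‖⁻¹ • ξ) i * A i j * (‖ξ‖⁻¹ • ξ) j) * ‖ξ‖ ^ 2 := by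
    rw [Finset.sum_mul]
    refine Finset.sum_congr rfl fun i _ => ?_
    rw [Finset.sum_mul]
    refine Finset.sum_congr rfl fun j _ => ?_
    simp only [PiLp.smul_apply, smul_eq_mul]
    field_simp
  rw [hscale]
  gcongr
  exact this

/-- The stress defect of a mixture of the states `(μp, p)` and `(μm, r)` with fractions `θ` and
`1 - θ`. -/
def stressDefect {n : ℕ} (μm μp e θ : ℝ) (p r : En n) (σ : Matrix (Fin n) (Fin n) ℝ) :
    Matrix (Fin n) (Fin n) ℝ :=
  e • (1 : Matrix (Fin n) (Fin n) ℝ) - (θ * μp) • op p p - ((1 - θ) * μm) • op r r + σ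

/-- Pairs of mixture parameters `(θ, p, r)` and relaxed states realised by them. -/
def mixtureGraph (n : ℕ) (μm μp e : ℝ) : Set ((ℝ × En n × En n) × Zsp n) :=
  {x | x.1.1 ∈ Set.Icc (0 : ℝ) 1 ∧ μp * ‖x.1.2.1‖ ^ 2 ≤ n * e ∧ μm * ‖x.1.2.2‖ ^ 2 ≤ n * e ∧
    x.2.1 = x.1.1 * μp + (1 - x.1.1) * μm ∧
    x.2.2.1 = x.1.1 • x.1.2.1 + (1 - x.1.1) • x.1.2.2 ∧
    x.2.2.2.1 = (x.1.1 * μp) • x.1.2.1 + ((1 - x.1.1) * μm) • x.1.2.2 ∧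
    ∀ ξ : Fin n → ℝ, 0 ≤ ξ ⬝ᵥ (stressDefect μm μp e x.1.1 x.1.2.1 x.1.2.2
      (x.2.2.2.2.1 : Matrix (Fin n) (Fin n) ℝ)).mulVec ξ}

lemma isClosed_mixtureGraph (n : ℕ) (μm μp e : ℝ) : IsClosed (mixtureGraph n μm μp e) := by
  have hop : Continuous fun v : En n => op v v := by
    refine continuous_matrix fun i j => ?_
    simp only [op]
    fun_prop
  simp only [mixtureGraph, Set.mem_Icc, Set.ofPred_and, Set.ofPred_forall]
  refine .inter (.inter ?_ ?_) (.inter ?_ (.inter ?_ (.inter ?_ (.inter ?_ (.inter ?_ ?_)))))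
  · exact isClosed_le (by fun_prop) (by fun_prop)
  · exact isClosed_le (by fun_prop) (by fun_prop)
  · exact isClosed_le (by fun_prop) (by fun_prop)
  · exact isClosed_le (by fun_prop) (by fun_prop)
  · exact isClosed_eq (by fun_prop) (by fun_prop)
  · exact isClosed_eq (by fun_prop) (by fun_prop)
  · exact isClosed_eq (by fun_prop) (by fun_prop)
  refine isClosed_iInter fun ξ => isClosed_le continuous_const ?_
  unfold stressDefect
  refine Continuous.dotProduct continuous_const (Continuous.matrix_mulVec ?_ continuous_const)
  have h₁ : Continuous fun x : (ℝ × En n × En n) × Zsp n => op x.1.2.1 x.1.2.1 :=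
    hop.comp (by fun_prop)
  have h₂ : Continuous fun x : (ℝ × En n × En n) × Zsp n => op x.1.2.2 x.1.2.2 :=
    hop.comp (by fun_prop)
  have h₃ : Continuous fun x : (ℝ × En n × En n) × Zsp n =>
      (x.2.2.2.2.1 : Matrix (Fin n) (Fin n) ℝ) :=
    continuous_subtype_val.comp (by fun_prop)
  have h₄ : Continuous fun x : (ℝ × En n × En n) × Zsp n => x.1.1 * μp := by fun_prop
  have h₅ : Continuous fun x : (ℝ × En n × En n) × Zsp n => (1 - x.1.1) * μm := by fun_prop
  exact ((continuous_const.sub (h₄.smul h₁)).sub (h₅.smul h₂)).add h₃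

lemma exists_mixture_of_mem_Uset {n : ℕ} (hn : 2 ≤ n) {μm μp e : ℝ} {z : Zsp n}
    (hz : z ∈ Uset n μm μp e) : ∃ x, (x, z) ∈ mixtureGraph n μm μp e := by
  obtain ⟨μ, w, m, σ, q⟩ := z
  obtain ⟨⟨h₁, h₂⟩, hTp, hTm, hQ⟩ := hz
  simp only [TpZ, TmZ, QZ, Tp, Tm] at h₁ h₂ hTp hTm hQ
  have hn' : (0 : ℝ) < n := by positivity
  have ha : 0 < μ - μm := sub_pos.2 h₁
  have hb : 0 < μp - μ := sub_pos.2 h₂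
  have hab : 0 < μp - μm := by linarith
  obtain ⟨θ, hθ⟩ : ∃ θ, θ = (μ - μm) / (μp - μm) := ⟨_, rfl⟩
  have hθ' : 1 - θ = (μp - μ) / (μp - μm) := by rw [hθ]; field_simp; ring
  refine ⟨(θ, (μ - μm)⁻¹ • (m - μm • w), (μp - μ)⁻¹ • (μp • w - m)), ⟨?_, ?_⟩, ?_, ?_, ?_, ?_, ?_,
    ?_⟩
  · rw [hθ]; positivity
  · rw [hθ, div_le_one hab]; linarith
  · rw [norm_smul, mul_pow, norm_inv, Real.norm_eq_abs, inv_pow, sq_abs]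
    field_simp at hTp ⊢
    nlinarith
  · rw [norm_smul, mul_pow, norm_inv, Real.norm_eq_abs, inv_pow, sq_abs, norm_sub_rev]
    have : (μ - μp) ^ 2 = (μp - μ) ^ 2 := by ring
    rw [this] at hTm
    field_simp at hTm ⊢
    nlinarith
  · simp only [hθ]; field_simp; ring
  · ext i
    simp only [hθ, PiLp.add_apply, PiLp.sub_apply, PiLp.smul_apply, smul_eq_mul]
    field_simp
    ring
  · ext i
    simp only [hθ, PiLp.add_apply, PiLp.sub_apply, PiLp.smul_apply, smul_eq_mul]
    field_simp
    ring
  · intro ξ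
    have hdefect : stressDefect μm μp e θ ((μ - μm)⁻¹ • (m - μm • w))
        ((μp - μ)⁻¹ • (μp • w - m)) σ = e • 1 - Mmat μm μp μ w m σ := by
      ext i j
      simp only [stressDefect, Mmat, hθ, Matrix.add_apply, Matrix.sub_apply,
        Matrix.smul_apply, op, PiLp.sub_apply, PiLp.smul_apply, smul_eq_mul]
      field_simp
      ring
    have hle := quadForm_le_lamMax (Mmat μm μp μ w m σ) (WithLp.toLp 2 ξ)
    have hform : ξ ⬝ᵥ (Mmat μm μp μ w m σ).mulVec ξ =
        ∑ i, ∑ j, ξ i * Mmat μm μp μ w m σ i j * ξ j := by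
      simp [dotProduct, Matrix.mulVec, Finset.mul_sum, mul_assoc]
    have hnorm : ξ ⬝ᵥ ξ = ‖WithLp.toLp 2 ξ‖ ^ 2 := by
      rw [EuclideanSpace.real_norm_sq_eq]
      simp [dotProduct, sq]
    simp only [hdefect, Matrix.sub_mulVec, Matrix.smul_mulVec, Matrix.one_mulVec, dotProduct_sub,
      dotProduct_smul, hform, hnorm, smul_eq_mul]
    have : 0 ≤ ‖WithLp.toLp 2 ξ‖ ^ 2 := by positivity
    simp only at hle
    nlinarith

lemma exists_mixture_of_mem_closure {n : ℕ} (hn : 2 ≤ n) {μm μp e : ℝ} (hμm : 0 < μm)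
    (hμ : μm < μp) {z : Zsp n} (hz : z ∈ closure (Uset n μm μp e)) :
    ∃ x, (x, z) ∈ mixtureGraph n μm μp e := by
  obtain ⟨u, hu, hlim⟩ := mem_closure_iff_ultrafilter.1 hz
  have hx : ∀ z : Zsp n, ∃ x, z ∈ Uset n μm μp e → (x, z) ∈ mixtureGraph n μm μp e := by
    intro z
    by_cases h : z ∈ Uset n μm μp e
    · exact (exists_mixture_of_mem_Uset hn h).imp fun _ hx _ => hx
    · exact ⟨0, fun h' => absurd h' h⟩
  choose x hx using hx
  have hball : ∀ (μ : ℝ) (v : En n), 0 < μ → μ * ‖v‖ ^ 2 ≤ n * e →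
      v ∈ Metric.closedBall (0 : En n) √(n * e / μ) := by
    intro μ v hpos hv
    rw [mem_closedBall_zero_iff]
    exact Real.le_sqrt_of_sq_le (by rw [le_div_iff₀ hpos]; linarith)
  have hcompact : IsCompact (Set.Icc (0 : ℝ) 1 ×ˢ Metric.closedBall (0 : En n) √(n * e / μp) ×ˢ
      Metric.closedBall (0 : En n) √(n * e / μm)) :=
    isCompact_Icc.prod ((isCompact_closedBall _ _).prod (isCompact_closedBall _ _))
  obtain ⟨y, -, hy⟩ := hcompact.ultrafilter_le_nhds (u.map x) (by
    rw [Filter.le_principal_iff, Ultrafilter.mem_coe, Ultrafilter.mem_map]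
    refine Filter.mem_of_superset hu fun k hk => ?_
    exact ⟨(hx k hk).1, hball _ _ (hμm.trans hμ) (hx k hk).2.1, hball _ _ hμm (hx k hk).2.2.1⟩)
  have hlim' : Filter.Tendsto (fun k => (x k, k)) u (nhds (y, z)) :=
    Filter.Tendsto.prodMk_nhds hy hlim
  exact ⟨y, (isClosed_mixtureGraph n μm μp e).mem_of_tendsto hlim'
    (by filter_upwards [hu] with k hk using hx k hk)⟩

/-- If `f : Z → ℝ` is `Λ`-convex and `f ≤ c` on `K`, then `f ≤ c` on
`closure(U)`; i.e. `closure(U)` is contained in the `Λ`-convex hull of `K`. -/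
theorem closure_U_subset_lambda_hull (n : ℕ) (hn : 2 ≤ n) (μm μp : ℝ) (hμm : 0 < μm)
    (hμ : μm < μp) (e : ℝ) (he : 0 < e) (f : Zsp n → ℝ)
    (hf : ∀ z : Zsp n, ∀ zb ∈ Lambda n, ConvexOn ℝ Set.univ (fun t : ℝ => f (z + t • zb)))
    (c : ℝ) (hc : ∀ z' ∈ Kset n μm μp e, f z' ≤ c) :
    ∀ z ∈ closure (Uset n μm μp e), f z ≤ c := by
  intro z hz
  obtain ⟨⟨θ, p, r⟩, ⟨hθ₀, hθ₁⟩, hp, hr, h₁, h₂, h₃, hpsd⟩ :=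
    exists_mixture_of_mem_closure hn hμm hμ hz
  obtain ⟨μ, w, m, σ, q⟩ := z
  simp only at hθ₀ hθ₁ hp hr h₁ h₂ h₃ hpsd
  subst h₁ h₂ h₃
  have hσsymm : (σ : Matrix (Fin n) (Fin n) ℝ)ᵀ = σ := σ.2.1
  have hF : (stressDefect μm μp e θ p r (σ : Matrix (Fin n) (Fin n) ℝ)).PosSemidef := by
    refine Matrix.PosSemidef.of_dotProduct_mulVec_nonneg ?_ fun ξ => by simpa using hpsd ξ
    rw [Matrix.IsHermitian, Matrix.conjTranspose_eq_transpose_of_trivial]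
    simp [stressDefect, transpose_op, hσsymm]
  obtain ⟨L₁, L₂, hL, hL₁, hL₂⟩ := exists_rankOne_splitting hF
    (a := θ * (n * e - μp * ‖p‖ ^ 2)) (b := (1 - θ) * (n * e - μm * ‖r‖ ^ 2))
    (mul_nonneg hθ₀ (by linarith)) (mul_nonneg (by linarith) (by linarith)) (by
      simp only [stressDefect, Matrix.trace_add, Matrix.trace_sub, Matrix.trace_smul,
        trace_op_self, Matrix.trace_one, Fintype.card_fin, trace_coe_S0, smul_eq_mul]
      ring)
  rw [stressDefect] at hL
  refine le_of_rankOne_splitting hn hf (sub_nonneg.2 hθ₁) hμm (n * e) _ q (θ • p) ((θ * μp) • p)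
    ((θ * μp) • op p p - e • 1 + (L₁.map fun x => op x x).sum) ?_ L₂ r σ ?_ hL₂
  · intro r' σ' hσ' hr'
    have key := le_of_rankOne_splitting hn hf hθ₀ (hμm.trans hμ) (n * e)
      (θ * μp + (1 - θ) * μm) q ((1 - θ) • r') (((1 - θ) * μm) • r')
      (((1 - θ) * μm) • op r' r' - e • 1) (c := c) ?_ L₁ p σ' ?_ hL₁
    · rwa [add_comm ((1 - θ) • r'), add_comm (((1 - θ) * μm) • r')] at key
    · intro p' τ hτ hp'
      rw [add_comm ((1 - θ) • r'), add_comm (((1 - θ) * μm) • r')]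
      exact le_of_saturated hn hμ hf hc hθ₀ hθ₁ q p' r' τ (by rw [hτ]; abel) hp' hr'
    · rw [hσ']; abel
  · rw [← sub_eq_zero] at hL ⊢
    rw [← hL]; abel
end
end

section
/- The function G₀ is uniformly strictly convex on [ρ₋, ρ₊]: there exists a constant c > 0 such that G₀''(ρ) ≥ c for all ρ ∈ [ρ₋, ρ₊]. -/
noncomputable section

/-- `Q₀(ρ) = (ρ − ρ₋)√ρ₋ + (ρ₊ − ρ)√ρ₊`. -/
def Q0 (ρm ρp ρ : ℝ) : ℝ := (ρ - ρm) * Real.sqrt ρm + (ρp - ρ) * Real.sqrt ρp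

/-- `G₀(ρ) = (ρ₊ − ρ)(ρ − ρ₋)(√ρ₋ − √ρ₊)/Q₀(ρ)`. -/
def G0 (ρm ρp ρ : ℝ) : ℝ :=
  (ρp - ρ) * (ρ - ρm) * (Real.sqrt ρm - Real.sqrt ρp) / Q0 ρm ρp ρ

/-- `ẽ₀(ρ) = ρ₊ρ₋(ρ₊ − ρ₋)²/(2 Q₀(ρ)²)`. -/
def e0 (ρm ρp ρ : ℝ) : ℝ := ρp * ρm * (ρp - ρm) ^ 2 / (2 * Q0 ρm ρp ρ ^ 2)

/-- Partial fraction form of `G0`. -/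
theorem G0_eq {ρm ρp x : ℝ} (hρm : 0 < ρm) (hρ : ρm < ρp)
    (hx : x < ρm + √ρm * √ρp + ρp) :
    G0 ρm ρp x = -x - √ρm * √ρp +
      √ρm * √ρp * (√ρm + √ρp) ^ 2 * (ρm + √ρm * √ρp + ρp - x)⁻¹ := by
  have hab : √ρm < √ρp := Real.sqrt_lt_sqrt hρm.le hρ
  have hm : √ρm ^ 2 = ρm := Real.sq_sqrt hρm.le
  have hp : √ρp ^ 2 = ρp := Real.sq_sqrt (hρm.trans hρ).le
  have ht : ρm + √ρm * √ρp + ρp - x ≠ 0 := by linarith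
  have hd : √ρp - √ρm ≠ 0 := by linarith
  have hQ : Q0 ρm ρp x = (√ρp - √ρm) * (ρm + √ρm * √ρp + ρp - x) := by
    unfold Q0
    linear_combination √ρp * hm - √ρm * hp
  rw [G0, hQ]
  generalize √ρm = a at *
  generalize √ρp = b at *
  subst hm hp
  rw [div_eq_iff (mul_ne_zero hd ht)]
  linear_combination (-(a * b * (a + b) ^ 2 * (b - a))) * inv_mul_cancel₀ ht

/-- Derivative of `y ↦ (S - y)⁻¹` to the left of its pole. -/
theorem hasDerivAt_inv_const_sub {S x : ℝ} (hx : x < S) :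
    HasDerivAt (fun y => (S - y)⁻¹) (((S - x) ^ 2)⁻¹) x := by
  simpa using ((hasDerivAt_id x).const_sub S).fun_inv (sub_pos.2 hx).ne'

theorem hasDerivAt_G0 {ρm ρp x : ℝ} (hρm : 0 < ρm) (hρ : ρm < ρp)
    (hx : x < ρm + √ρm * √ρp + ρp) :
    HasDerivAt (G0 ρm ρp)
      (-1 + √ρm * √ρp * (√ρm + √ρp) ^ 2 * ((ρm + √ρm * √ρp + ρp - x)⁻¹) ^ 2) x := by
  have h := (((hasDerivAt_id x).const_sub (-(√ρm * √ρp))).add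
    ((hasDerivAt_inv_const_sub hx).const_mul (√ρm * √ρp * (√ρm + √ρp) ^ 2)))
  rw [inv_pow]
  refine h.congr_of_eventuallyEq ?_
  filter_upwards [eventually_lt_nhds hx] with y hy
  rw [G0_eq hρm hρ hy]
  simp only [Pi.add_apply, id]
  ring

theorem deriv_deriv_G0 {ρm ρp x : ℝ} (hρm : 0 < ρm) (hρ : ρm < ρp)
    (hx : x < ρm + √ρm * √ρp + ρp) :
    deriv (deriv (G0 ρm ρp)) x =
      2 * (√ρm * √ρp * (√ρm + √ρp) ^ 2) / (ρm + √ρm * √ρp + ρp - x) ^ 3 := by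
  have h := (((hasDerivAt_inv_const_sub hx).fun_pow 2).const_mul
    (√ρm * √ρp * (√ρm + √ρp) ^ 2)).const_add (-1)
  have he : deriv (G0 ρm ρp) =ᶠ[nhds x] fun y =>
      -1 + √ρm * √ρp * (√ρm + √ρp) ^ 2 * ((ρm + √ρm * √ρp + ρp - y)⁻¹) ^ 2 := by
    filter_upwards [eventually_lt_nhds hx] with y hy
    exact (hasDerivAt_G0 hρm hρ hy).deriv
  rw [he.deriv_eq, h.deriv]
  generalize ρm + √ρm * √ρp + ρp - x = t
  norm_num
  ring

/-- `G₀` is uniformly strictly convex on `[ρ₋, ρ₊]`: there is `c > 0`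
with `G₀''(ρ) ≥ c` for all `ρ ∈ [ρ₋, ρ₊]`. -/
theorem G0_uniformly_convex (ρm ρp : ℝ) (hρm : 0 < ρm) (hρ : ρm < ρp) :
    ∃ c : ℝ, 0 < c ∧ ∀ ρ ∈ Set.Icc ρm ρp, c ≤ deriv (deriv (G0 ρm ρp)) ρ := by
  have hrm : 0 < √ρm := Real.sqrt_pos.2 hρm
  have hab : √ρm < √ρp := Real.sqrt_lt_sqrt hρm.le hρ
  have hm : √ρm ^ 2 = ρm := Real.sq_sqrt hρm.le
  have hp : √ρp ^ 2 = ρp := Real.sq_sqrt (hρm.trans hρ).le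
  have hrp : 0 < √ρp := hrm.trans hab
  refine ⟨2 * (√ρm * √ρp * (√ρm + √ρp) ^ 2) / (√ρp * (√ρm + √ρp)) ^ 3, by positivity, ?_⟩
  rintro ρ ⟨hl, hu⟩
  have hpos : 0 < ρm + √ρm * √ρp + ρp - ρ := by nlinarith [mul_pos hrm hrp]
  rw [deriv_deriv_G0 hρm hρ (by linarith)]
  gcongr
  nlinarith
end
end

section
/- There holds the integral identity ∫_{ρ₋}^{ρ₊} G₀'(ρ)² dρ = (√ρ₊ + √ρ₋)·(√ρ₊ − √ρ₋)³ / (3·√(ρ₊·ρ₋)). -/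
noncomputable section

lemma Q0_pos {ρm ρp ρ : ℝ} (hρm : 0 < ρm) (hρ : ρm < ρp) (h : ρ ∈ Set.Icc ρm ρp) :
    0 < Q0 ρm ρp ρ := by
  have ha := Real.sqrt_pos.2 hρm
  have hb := Real.sqrt_lt_sqrt hρm.le hρ
  have h1 := mul_nonneg (sub_nonneg.2 h.2) (sub_nonneg.2 hb.le)
  have h2 := mul_pos (sub_pos.2 hρ) ha
  unfold Q0
  linarith

lemma hasDerivAt_Q0 (ρm ρp ρ : ℝ) :
    HasDerivAt (Q0 ρm ρp) (Real.sqrt ρm - Real.sqrt ρp) ρ := by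
  have h := (((hasDerivAt_id ρ).sub_const ρm).mul_const (Real.sqrt ρm)).add
    (((hasDerivAt_id ρ).const_sub ρp).mul_const (Real.sqrt ρp))
  exact h.congr_deriv (by ring)

/-- Where `Q₀ ≠ 0`, `G₀' = √ρ₋ √ρ₊ (ρ₊ − ρ₋)² / Q₀² − 1`. -/
lemma hasDerivAt_G0_s19 {ρm ρp ρ : ℝ} (hQ : Q0 ρm ρp ρ ≠ 0) :
    HasDerivAt (G0 ρm ρp)
      (Real.sqrt ρm * Real.sqrt ρp * (ρp - ρm) ^ 2 / Q0 ρm ρp ρ ^ 2 - 1) ρ := by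
  have h := (((((hasDerivAt_id ρ).const_sub ρp).mul ((hasDerivAt_id ρ).sub_const ρm)).mul_const
    (Real.sqrt ρm - Real.sqrt ρp))).div (hasDerivAt_Q0 ρm ρp ρ) hQ
  refine h.congr_deriv ?_
  simp only [Pi.mul_apply, id]
  rw [div_sub_one (pow_ne_zero 2 hQ)]
  congr 1
  unfold Q0
  obtain ⟨a, ha⟩ : ∃ a, a = Real.sqrt ρm := ⟨_, rfl⟩
  obtain ⟨b, hb⟩ : ∃ b, b = Real.sqrt ρp := ⟨_, rfl⟩
  rw [← ha, ← hb]
  ring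

/-- `∫_{ρ₋}^{ρ₊} G₀'(ρ)² dρ = (√ρ₊ + √ρ₋)(√ρ₊ − √ρ₋)³/(3√(ρ₊ρ₋))`. -/
theorem integral_G0_deriv_sq (ρm ρp : ℝ) (hρm : 0 < ρm) (hρ : ρm < ρp) :
    ∫ ρ in ρm..ρp, (deriv (G0 ρm ρp) ρ) ^ 2 =
      (Real.sqrt ρp + Real.sqrt ρm) * (Real.sqrt ρp - Real.sqrt ρm) ^ 3 /
        (3 * Real.sqrt (ρp * ρm)) := by
  set a := Real.sqrt ρm with ha
  set b := Real.sqrt ρp with hb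
  have ha0 : 0 < a := Real.sqrt_pos.2 hρm
  have hab : a < b := Real.sqrt_lt_sqrt hρm.le hρ
  have hb0 : 0 < b := ha0.trans hab
  have ham : ρm = a ^ 2 := (Real.sq_sqrt hρm.le).symm
  have hbp : ρp = b ^ 2 := (Real.sq_sqrt (hρm.trans hρ).le).symm
  have hc : a - b ≠ 0 := (sub_neg.2 hab).ne
  have hs : 0 < a + b := add_pos ha0 hb0
  set K := a * b * (ρp - ρm) ^ 2 with hK
  have hQ : ∀ ρ ∈ Set.uIcc ρm ρp, Q0 ρm ρp ρ ≠ 0 := fun ρ h =>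
    (Q0_pos hρm hρ (Set.uIcc_of_le hρ.le ▸ h)).ne'
  have hcongr : Set.EqOn (fun ρ => (deriv (G0 ρm ρp) ρ) ^ 2)
      (fun ρ => (K / Q0 ρm ρp ρ ^ 2 - 1) ^ 2) (Set.uIcc ρm ρp) := fun ρ h => by
    simp only [(hasDerivAt_G0_s19 (hQ ρ h)).deriv, hK, ha, hb]
  have hF : ∀ ρ ∈ Set.uIcc ρm ρp, HasDerivAt
      (fun ρ => 2 * K / (a - b) * (Q0 ρm ρp ρ)⁻¹ -
        K ^ 2 / (3 * (a - b)) * (Q0 ρm ρp ρ ^ 3)⁻¹ + ρ)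
      ((K / Q0 ρm ρp ρ ^ 2 - 1) ^ 2) ρ := fun ρ h => by
    have hq := hQ ρ h
    have hd := hasDerivAt_Q0 ρm ρp ρ
    refine ((((hd.inv hq).const_mul (2 * K / (a - b))).sub
      (((hd.pow 3).inv (pow_ne_zero 3 hq)).const_mul (K ^ 2 / (3 * (a - b))))).add
      (hasDerivAt_id ρ)).congr_deriv ?_
    simp only [Pi.pow_apply, ← ha, ← hb]
    field_simp
    ring
  have hcont : ContinuousOn (fun ρ => (K / Q0 ρm ρp ρ ^ 2 - 1) ^ 2) (Set.uIcc ρm ρp) := by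
    have hQc : ContinuousOn (Q0 ρm ρp) (Set.uIcc ρm ρp) := fun ρ _ =>
      (hasDerivAt_Q0 ρm ρp ρ).continuousAt.continuousWithinAt
    exact ((continuousOn_const.div (hQc.pow 2) fun ρ h => pow_ne_zero 2 (hQ ρ h)).sub
      continuousOn_const).pow 2
  have hm : Q0 ρm ρp ρm = -((a - b) * (a + b) * b) := by
    simp only [Q0, ← ha, ← hb]; rw [ham, hbp]; ring
  have hp : Q0 ρm ρp ρp = -((a - b) * (a + b) * a) := by
    simp only [Q0, ← ha, ← hb]; rw [ham, hbp]; ring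
  have hK' : K = a * b * ((a - b) * (a + b)) ^ 2 := by rw [hK, ham, hbp]; ring
  rw [intervalIntegral.integral_congr hcongr,
    intervalIntegral.integral_eq_sub_of_hasDerivAt hF hcont.intervalIntegrable,
    Real.sqrt_mul (hρm.trans hρ).le, ← ha, ← hb, hm, hp, hK']
  clear_value a b
  subst ham hbp
  field_simp
  ring
end
end
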